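/- arXiv:1204.4666 — 3 statements merged into one kernel-verified Lean document; each statement's English description precedes it below -/
import Mathlib

section
/- Let S ⊆ V be a nonempty set of vertices. Then the smallest eigenvalue λ_S of the submatrix 𝓛_S of the normalized Laplacian satisfies λ_S ≤ |δ(S)|/vol(S), i.e., λ_S ≤ φ(S). -/
open Finset

namespace SSC

variable {V : Type*} [Fintype V] [DecidableEq V]

/-- The volume of a set of vertices: the sum of the degrees. -/
noncomputable def vol (G : SimpleGraph V) [DecidableRel G.Adj] (S : Finset V) : ℝ :=
  ∑ v ∈ S, (G.degree v : ℝ)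

/-- The number of edges with exactly one endpoint in `S` (counted as ordered pairs
`(u, v)` with `u ∈ S`, `v ∉ S`, which counts each such undirected edge once). -/
noncomputable def cut (G : SimpleGraph V) [DecidableRel G.Adj] (S : Finset V) : ℝ :=
  (((S ×ˢ Sᶜ)).filter (fun e => G.Adj e.1 e.2)).card

/-- The conductance `φ(S) = |δ(S)| / vol(S)` of a set of vertices. -/
noncomputable def cond (G : SimpleGraph V) [DecidableRel G.Adj] (S : Finset V) : ℝ :=
  cut G S / vol G S

/-- `φ_k(G)`: the minimum conductance over nonempty sets of volume at most `k`. -/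
noncomputable def phiK (G : SimpleGraph V) [DecidableRel G.Adj] (k : ℝ) : ℝ :=
  sInf {c : ℝ | ∃ S : Finset V, S.Nonempty ∧ vol G S ≤ k ∧ c = cond G S}

/-- The lazy random walk matrix `W = (I + D⁻¹A)/2`. -/
noncomputable def lazyW (G : SimpleGraph V) [DecidableRel G.Adj] : Matrix V V ℝ :=
  fun u v => (if u = v then (1 : ℝ) / 2 else 0) +
    (if G.Adj u v then 1 / (2 * (G.degree u : ℝ)) else 0)

/-- The distribution after `t` steps of lazy random walk: `p_t = p₀ Wᵗ` (row vector). -/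
noncomputable def walk (G : SimpleGraph V) [DecidableRel G.Adj] (p₀ : V → ℝ) (t : ℕ) : V → ℝ :=
  Matrix.vecMul p₀ (lazyW G ^ t)

/-- The distribution concentrated at a vertex `u`. -/
def chi (u : V) : V → ℝ := fun v => if v = u then 1 else 0

/-- The directed edges of `G`: ordered pairs of adjacent vertices (each undirected
edge appears twice, once in each direction). -/
def dirEdges (G : SimpleGraph V) [DecidableRel G.Adj] : Finset (V × V) :=
  Finset.univ.filter fun e => G.Adj e.1 e.2

/-- The Lovász–Simonovits curve of a vector `p` on the vertices: each directed edge
`e = (u, v)` gets value `q(e) = p(u)/d(u)`, and `C(x)` is the maximum of `∑ w(e) q(e)`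
over fractional edge-subsets `0 ≤ w ≤ 1` of total size `x`; for integer `x` this is the
sum of the `x` largest values `q(e)`, extended piecewise linearly in between. -/
noncomputable def curve (G : SimpleGraph V) [DecidableRel G.Adj] (p : V → ℝ) (x : ℝ) : ℝ :=
  sSup {s : ℝ | ∃ w : V × V → ℝ,
      (∀ e ∈ dirEdges G, 0 ≤ w e ∧ w e ≤ 1) ∧
      (∑ e ∈ dirEdges G, w e) = x ∧
      s = ∑ e ∈ dirEdges G, w e * (p e.1 / (G.degree e.1 : ℝ))}

/-- `S` is a level set of the vector `p`: `S` is nonempty and consists of vertices with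
the largest values of `p(v)/d(v)`, i.e. `S = {v₁, …, v_j}` for some ordering of the
vertices with `p(v₁)/d(v₁) ≥ … ≥ p(v_n)/d(v_n)`. Its volume is then an extreme point
of the Lovász–Simonovits curve of `p`, with `C(vol S) = ∑_{v ∈ S} p v`. -/
def IsLevelSet (G : SimpleGraph V) [DecidableRel G.Adj] (p : V → ℝ) (S : Finset V) : Prop :=
  S.Nonempty ∧ ∀ u ∈ S, ∀ v, v ∉ S → p v / (G.degree v : ℝ) ≤ p u / (G.degree u : ℝ)

/-- Truncation with threshold `ε`: set to zero every entry with `q(v) < ε·d(v)`. -/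
noncomputable def truncStep (G : SimpleGraph V) [DecidableRel G.Adj] (ε : ℝ) (q : V → ℝ) :
    V → ℝ := fun v => if ε * (G.degree v : ℝ) ≤ q v then q v else 0

/-- The truncated lazy random walk with threshold `ε` started at `u`:
`q₀ = χ_u`, `p̃_t = truncation of q_t`, `q_{t+1} = p̃_t W`.  `twalk G ε u t` is `p̃_t`. -/
noncomputable def twalk (G : SimpleGraph V) [DecidableRel G.Adj] (ε : ℝ) (u : V) :
    ℕ → V → ℝ
  | 0 => truncStep G ε (chi u)
  | t + 1 => truncStep G ε (Matrix.vecMul (twalk G ε u t) (lazyW G))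

/-- The (combinatorial) Laplacian matrix `L = D - A`. -/
noncomputable def lapl (G : SimpleGraph V) [DecidableRel G.Adj] : Matrix V V ℝ :=
  fun u v => (if u = v then (G.degree u : ℝ) else 0) - (if G.Adj u v then 1 else 0)

/-- The normalized Laplacian matrix `𝓛 = D^{-1/2} L D^{-1/2}`. -/
noncomputable def normLapl (G : SimpleGraph V) [DecidableRel G.Adj] : Matrix V V ℝ :=
  fun u v => lapl G u v / (Real.sqrt (G.degree u) * Real.sqrt (G.degree v))

end SSC

/-- The smallest eigenvalue of a real symmetric matrix bounds its quadratic form from below. -/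
theorem Matrix.IsHermitian.iInf_eigenvalues_mul_dotProduct_le {n : Type*} [Fintype n]
    [DecidableEq n] {A : Matrix n n ℝ} (hA : A.IsHermitian) (x : n → ℝ) :
    (⨅ i, hA.eigenvalues i) * (x ⬝ᵥ x) ≤ x ⬝ᵥ (A.mulVec x) := by
  have hsym : A.IsSymm := by simpa using hA
  have hparseval (y z : n → ℝ) :
      y ⬝ᵥ z = ∑ i, (y ⬝ᵥ hA.eigenvectorBasis i) * (z ⬝ᵥ hA.eigenvectorBasis i) := by
    have h := hA.eigenvectorBasis.sum_inner_mul_inner (WithLp.toLp 2 y) (WithLp.toLp 2 z)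
    simp only [EuclideanSpace.inner_eq_star_dotProduct, star_trivial] at h
    rw [dotProduct_comm y z, ← h]
    exact Finset.sum_congr rfl fun i _ => by rw [dotProduct_comm y]
  have hcoord (i : n) : (A.mulVec x) ⬝ᵥ hA.eigenvectorBasis i
      = hA.eigenvalues i * (x ⬝ᵥ hA.eigenvectorBasis i) := by
    rw [← Matrix.vecMul_transpose, hsym.eq, ← Matrix.dotProduct_mulVec,
      hA.mulVec_eigenvectorBasis, dotProduct_smul, smul_eq_mul]
  rw [hparseval x x, hparseval x (A.mulVec x), Finset.mul_sum]
  refine Finset.sum_le_sum fun i _ => ?_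
  rw [hcoord]
  have h := mul_le_mul_of_nonneg_right (ciInf_le (Set.finite_range hA.eigenvalues).bddBelow i)
    (mul_self_nonneg (x ⬝ᵥ hA.eigenvectorBasis i))
  linarith

namespace SSC

theorem lapl_eq_zero_of_degree_left {V : Type*} [Fintype V] [DecidableEq V]
    (G : SimpleGraph V) [DecidableRel G.Adj] {u : V} (v : V) (hu : G.degree u = 0) :
    lapl G u v = 0 := by
  have hadj : ¬ G.Adj u v := fun h =>
    (G.degree_pos_iff_exists_adj u).mpr ⟨v, h⟩ |>.ne' hu
  simp [lapl, hu, hadj]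

theorem lapl_comm {V : Type*} [Fintype V] [DecidableEq V]
    (G : SimpleGraph V) [DecidableRel G.Adj] (u v : V) : lapl G u v = lapl G v u := by
  by_cases h : u = v
  · rw [h]
  · simp [lapl, h, Ne.symm h, G.adj_comm]

theorem sqrt_mul_normLapl_mul_sqrt {V : Type*} [Fintype V] [DecidableEq V]
    (G : SimpleGraph V) [DecidableRel G.Adj] (u v : V) :
    √(G.degree u) * (normLapl G u v * √(G.degree v)) = lapl G u v := by
  by_cases hu : G.degree u = 0
  · simp [hu, lapl_eq_zero_of_degree_left G v hu]
  by_cases hv : G.degree v = 0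
  · simp [hv, lapl_comm G u v, lapl_eq_zero_of_degree_left G u hv]
  have hu' : √(G.degree u : ℝ) ≠ 0 := by positivity
  have hv' : √(G.degree v : ℝ) ≠ 0 := by positivity
  unfold normLapl
  field_simp

theorem sum_sum_lapl_eq_cut {V : Type*} [Fintype V] [DecidableEq V]
    (G : SimpleGraph V) [DecidableRel G.Adj] (S : Finset V) :
    ∑ u ∈ S, ∑ v ∈ S, lapl G u v = cut G S := by
  have hcut : cut G S = ∑ u ∈ S, ∑ v ∈ Sᶜ, if G.Adj u v then (1 : ℝ) else 0 := by
    rw [cut, ← Finset.sum_product', Finset.sum_boole]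
  rw [hcut]
  refine Finset.sum_congr rfl fun u hu => ?_
  have hdeg : (G.degree u : ℝ) = ∑ v, if G.Adj u v then (1 : ℝ) else 0 := by
    rw [Finset.sum_boole, ← G.card_neighborFinset_eq_degree, G.neighborFinset_eq_filter]
  rw [← Finset.sum_add_sum_compl S] at hdeg
  simp only [lapl, Finset.sum_sub_distrib, Finset.sum_ite_eq, hu, if_true]
  linarith

end SSC

/-- For a nonempty set of vertices `S`, the smallest eigenvalue `λ_S` of
the submatrix `𝓛_S` of the normalized Laplacian satisfies `λ_S ≤ |δ(S)|/vol(S) = φ(S)`. -/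
theorem smallest_eigenvalue_le_conductance
    {V : Type*} [Fintype V] [DecidableEq V]
    (G : SimpleGraph V) [DecidableRel G.Adj] (hG : G.Connected)
    (S : Finset V) (hS : S.Nonempty)
    (hH : ((SSC.normLapl G).submatrix (fun i : S => (i : V)) (fun i : S => (i : V))).IsHermitian) :
    (⨅ i : S, hH.eigenvalues i) ≤ SSC.cond G S := by
  have : Nonempty S := hS.to_subtype
  by_cases hvol : SSC.vol G S = 0
  · have hdeg : ∀ u ∈ S, G.degree u = 0 := by
      intro u hu
      have h := (Finset.sum_eq_zero_iff_of_nonneg fun v _ => Nat.cast_nonneg _).mp hvol u hu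
      exact_mod_cast h
    have hzero : (SSC.normLapl G).submatrix (fun i : S => (i : V)) (fun i : S => (i : V)) = 0 := by
      ext i j
      simp [SSC.normLapl, SSC.lapl_eq_zero_of_degree_left G _ (hdeg i i.2)]
    have h := hH.iInf_eigenvalues_mul_dotProduct_le (fun _ => 1)
    have hone : (0 : ℝ) < (fun _ : S => (1 : ℝ)) ⬝ᵥ (fun _ : S => (1 : ℝ)) := by
      simpa [dotProduct] using hS
    have hform := congrArg (fun B => (fun _ : S => (1 : ℝ)) ⬝ᵥ B.mulVec fun _ : S => (1 : ℝ)) hzero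
    simp only [Matrix.zero_mulVec, dotProduct_zero] at hform
    rw [hform] at h
    rw [SSC.cond, hvol, div_zero]
    exact nonpos_of_mul_nonpos_left h hone
  · have hpos : 0 < SSC.vol G S :=
      lt_of_le_of_ne (Finset.sum_nonneg fun v _ => Nat.cast_nonneg _) (Ne.symm hvol)
    have h := hH.iInf_eigenvalues_mul_dotProduct_le (fun i => √(G.degree (i : V)))
    have hnorm : (fun i : S => √(G.degree (i : V) : ℝ)) ⬝ᵥ (fun i : S => √(G.degree (i : V) : ℝ))
        = SSC.vol G S := by
      simp only [dotProduct, Real.mul_self_sqrt (Nat.cast_nonneg _)]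
      exact Finset.sum_coe_sort S fun v => (G.degree v : ℝ)
    have hform : (fun i : S => √(G.degree (i : V) : ℝ)) ⬝ᵥ
        (((SSC.normLapl G).submatrix (fun i : S => (i : V)) (fun i : S => (i : V))).mulVec
          fun i : S => √(G.degree (i : V) : ℝ)) = SSC.cut G S := by
      simp only [dotProduct, Matrix.mulVec, Matrix.submatrix_apply, Finset.mul_sum,
        SSC.sqrt_mul_normLapl_mul_sqrt]
      rw [← SSC.sum_sum_lapl_eq_cut, ← Finset.sum_coe_sort S]
      exact Finset.sum_congr rfl fun i _ => Finset.sum_coe_sort S fun v => SSC.lapl G i v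
    rw [hnorm, hform] at h
    exact (le_div_iff₀ hpos).mpr h
end

section
/- Let S ⊆ V be nonempty with the induced subgraph on S connected, let λ_S be the smallest eigenvalue of 𝓛_S and v_S a corresponding entrywise-positive eigenvector scaled so that ‖D_S^{1/2} v_S‖₁ = 1. Define the initial distribution p₀ by p₀ = (D_S^{1/2} v_S)ᵀ on S and p₀ = 0 on V∖S, and let p_t = p₀Wᵗ. Then for every t ≥ 0, the restriction of p_t to S satisfies p_{t,S} ≥ (1 − λ_S/2)^t · p_{0,S} entrywise; in particular p_t(S) ≥ (1 − λ_S/2)^t. -/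
open Finset

namespace SSC

variable {V : Type*} [Fintype V] [DecidableEq V]

lemma lazyW_nonneg (G : SimpleGraph V) [DecidableRel G.Adj] (u v : V) : 0 ≤ lazyW G u v := by
  unfold lazyW
  split_ifs <;> positivity

lemma walk_zero (G : SimpleGraph V) [DecidableRel G.Adj] (p : V → ℝ) : walk G p 0 = p := by
  simp [walk]

lemma walk_succ (G : SimpleGraph V) [DecidableRel G.Adj] (p : V → ℝ) (t : ℕ) (v : V) :
    walk G p (t + 1) v = ∑ u, walk G p t u * lazyW G u v := by
  rw [walk, pow_succ, ← Matrix.vecMul_vecMul]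
  rfl

lemma walk_nonneg (G : SimpleGraph V) [DecidableRel G.Adj] {p : V → ℝ} (hp : ∀ v, 0 ≤ p v)
    (t : ℕ) (v : V) : 0 ≤ walk G p t v := by
  induction t generalizing v with
  | zero => simpa [walk_zero] using hp v
  | succ t ih =>
    rw [walk_succ]
    exact Finset.sum_nonneg fun u _ => mul_nonneg (ih u) (lazyW_nonneg G u v)

/-- The similarity `D^{1/2} W D^{-1/2} = I - 𝓛 / 2`, in a form that also holds at isolated
vertices. -/
lemma sqrt_degree_mul_lazyW (G : SimpleGraph V) [DecidableRel G.Adj] (u v : V) :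
    Real.sqrt (G.degree u) * lazyW G u v =
      Real.sqrt (G.degree v) * ((if u = v then 1 else 0) - normLapl G v u / 2) := by
  unfold lazyW normLapl lapl
  by_cases huv : u = v
  · subst huv
    rcases eq_or_ne (G.degree u) 0 with h | h
    · simp [h]
    · have hd : (G.degree u : ℝ) ≠ 0 := by exact_mod_cast h
      simp [hd]
      ring
  · by_cases hadj : G.Adj u v
    · have hu : 0 < (G.degree u : ℝ) := by
        exact_mod_cast (G.degree_pos_iff_exists_adj u).2 ⟨v, hadj⟩
      have hv : 0 < (G.degree v : ℝ) := by
        exact_mod_cast (G.degree_pos_iff_exists_adj v).2 ⟨u, hadj.symm⟩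
      have hsu := Real.sqrt_pos.2 hu
      have hsv := Real.sqrt_pos.2 hv
      simp only [huv, Ne.symm huv, hadj, hadj.symm, if_true, if_false]
      field_simp
      rw [Real.sq_sqrt hu.le]
      ring
    · simp [huv, Ne.symm huv, hadj, mt SimpleGraph.Adj.symm hadj]

/-- If `p W` agrees with `c p` at every vertex where `p` is nonzero, then `p Wᵗ` dominates
`cᵗ p`. -/
lemma pow_mul_le_walk (G : SimpleGraph V) [DecidableRel G.Adj] {p : V → ℝ} (hp : ∀ v, 0 ≤ p v)
    {c : ℝ} (hc : ∀ v, p v ≠ 0 → ∑ u, p u * lazyW G u v = c * p v) (t : ℕ) (v : V) :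
    c ^ t * p v ≤ walk G p t v := by
  induction t generalizing v with
  | zero => simp [walk_zero]
  | succ t ih =>
    by_cases hv : p v = 0
    · simpa [hv] using walk_nonneg G hp (t + 1) v
    · calc c ^ (t + 1) * p v = c ^ t * ∑ u, p u * lazyW G u v := by rw [hc v hv]; ring
        _ = ∑ u, (c ^ t * p u) * lazyW G u v := by simp only [Finset.mul_sum, mul_assoc]
        _ ≤ ∑ u, walk G p t u * lazyW G u v :=
          Finset.sum_le_sum fun u _ => mul_le_mul_of_nonneg_right (ih u) (lazyW_nonneg G u v)
        _ = walk G p (t + 1) v := (walk_succ G p t v).symm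

end SSC

/-- Let `S` be nonempty with connected induced subgraph, let `lam` be the
smallest eigenvalue of `𝓛_S` with a corresponding entrywise-positive eigenvector `vS`
normalized so that `‖D_S^{1/2} vS‖₁ = 1`.  Start the lazy walk from
`p₀ = (D_S^{1/2} vS)ᵀ` on `S` (and `0` off `S`).  Then for every `t ≥ 0` the restriction
of `p_t` to `S` dominates `(1 − lam/2)^t p₀` entrywise; in particular
`p_t(S) ≥ (1 − lam/2)^t`. -/
theorem local_eigenvector_lower_bound
    {V : Type*} [Fintype V] [DecidableEq V]
    (G : SimpleGraph V) [DecidableRel G.Adj] (hG : G.Connected)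
    (S : Finset V) (hS : S.Nonempty)
    (hconn : (G.induce (S : Set V)).Connected)
    (lam : ℝ) (vS : S → ℝ)
    (heig : Matrix.mulVec
        ((SSC.normLapl G).submatrix (fun i : S => (i : V)) (fun i : S => (i : V))) vS
      = lam • vS)
    (hsmallest : ∀ μ : ℝ, (∃ w : S → ℝ, w ≠ 0 ∧
        Matrix.mulVec
          ((SSC.normLapl G).submatrix (fun i : S => (i : V)) (fun i : S => (i : V))) w
          = μ • w) → lam ≤ μ)
    (hpos : ∀ i : S, 0 < vS i)
    (hnorm : ∑ i : S, |Real.sqrt (G.degree (i : V)) * vS i| = 1)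
    (p₀ : V → ℝ)
    (hp₀ : p₀ = fun u => if h : u ∈ S then Real.sqrt (G.degree u) * vS ⟨u, h⟩ else 0) :
    ∀ t : ℕ,
      (∀ i : S, (1 - lam / 2) ^ t * p₀ (i : V) ≤ SSC.walk G p₀ t (i : V)) ∧
      (1 - lam / 2) ^ t ≤ ∑ u ∈ S, SSC.walk G p₀ t u := by
  have hmem : ∀ i : S, p₀ i = Real.sqrt (G.degree (i : V)) * vS i := fun i => by simp [hp₀]
  have hnot : ∀ u, u ∉ S → p₀ u = 0 := fun u hu => by simp [hp₀, hu]
  have hp : ∀ u, 0 ≤ p₀ u := fun u => by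
    by_cases hu : u ∈ S
    · rw [hmem ⟨u, hu⟩]
      exact mul_nonneg (Real.sqrt_nonneg _) (hpos _).le
    · exact (hnot u hu).ge
  have hsum : ∑ u ∈ S, p₀ u = 1 := by
    rw [← hnorm, ← Finset.sum_coe_sort S]
    refine Finset.sum_congr rfl fun i _ => ?_
    rw [← hmem i, abs_of_nonneg (hp i)]
  have hstep : ∀ v, p₀ v ≠ 0 → ∑ u, p₀ u * SSC.lazyW G u v = (1 - lam / 2) * p₀ v := by
    intro v hv
    have hvS : v ∈ S := by_contra fun h => hv (hnot v h)
    have hrow : ∑ i : S, SSC.normLapl G v i * vS i = lam * vS ⟨v, hvS⟩ :=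
      congrFun heig ⟨v, hvS⟩
    calc ∑ u, p₀ u * SSC.lazyW G u v
        = ∑ u ∈ S, p₀ u * SSC.lazyW G u v :=
          (Finset.sum_subset (Finset.subset_univ S) fun u _ hu => by simp [hnot u hu]).symm
      _ = ∑ i : S, p₀ i * SSC.lazyW G i v := (Finset.sum_coe_sort S _).symm
      _ = ∑ i : S, ((if i = ⟨v, hvS⟩ then Real.sqrt (G.degree v) * vS i else 0) -
            Real.sqrt (G.degree v) / 2 * (SSC.normLapl G v i * vS i)) := by
          refine Finset.sum_congr rfl fun i _ => ?_
          rw [hmem i, mul_right_comm, SSC.sqrt_degree_mul_lazyW]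
          simp only [Subtype.ext_iff]
          split_ifs <;> ring
      _ = (1 - lam / 2) * p₀ v := by
          rw [Finset.sum_sub_distrib, ← Finset.mul_sum, hrow, hmem ⟨v, hvS⟩]
          simp only [Finset.sum_ite_eq', Finset.mem_univ, if_true]
          ring
  intro t
  have hdom := SSC.pow_mul_le_walk G hp hstep t
  refine ⟨fun i => hdom i, ?_⟩
  calc (1 - lam / 2) ^ t = ∑ u ∈ S, (1 - lam / 2) ^ t * p₀ u := by
        rw [← Finset.mul_sum, hsum, mul_one]
    _ ≤ ∑ u ∈ S, SSC.walk G p₀ t u := Finset.sum_le_sum fun u _ => hdom u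
end

section
/- Let G be a d-regular graph, let M ≥ 2 and k ≥ 1 be integers, and let S ⊆ V with |S| = Mk. Then there exists a subset S' ⊆ S with |S'| = k such that |δ(S')| ≤ |δ(S)| + (2k(Mk−k)/(Mk(Mk−1)))·|E(S)|, where E(S) is the set of edges with both endpoints in S. Consequently, since vol(S') = kd and |E(S)| ≤ Mkd/2, this S' satisfies φ(S') ≤ M·φ(S) + (Mk−k)/(Mk−1). -/
open Finset

namespace SSC

theorem card_powersetCard_filter_mem_notMem {V : Type*} [DecidableEq V]
    (S : Finset V) (j : ℕ) {u v : V}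
    (hu : u ∈ S) (huv : u ≠ v) :
    ((S.powersetCard (j + 1)).filter fun T => u ∈ T ∧ v ∉ T).card =
      ((S.erase u).erase v).card.choose j := by
  have himage : (S.powersetCard (j + 1)).filter (fun T => u ∈ T ∧ v ∉ T) =
      (((S.erase u).erase v).powersetCard j).image (insert u) := by
    ext T
    simp only [mem_filter, mem_powersetCard, mem_image]
    constructor
    · rintro ⟨⟨hTS, hcard⟩, huT, hvT⟩
      refine ⟨T.erase u, ⟨?_, ?_⟩, insert_erase huT⟩
      · intro x hx
        rw [mem_erase] at hx
        simp only [mem_erase]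
        exact ⟨fun h => hvT (h ▸ hx.2), hx.1, hTS hx.2⟩
      · rw [card_erase_of_mem huT, hcard, Nat.add_sub_cancel]
    · rintro ⟨A, ⟨hA, hcard⟩, rfl⟩
      have huA : u ∉ A := fun h => by simpa using hA h
      have hvA : v ∉ A := fun h => by simpa using hA h
      refine ⟨⟨?_, ?_⟩, mem_insert_self _ _, ?_⟩
      · exact insert_subset hu (hA.trans ((erase_subset _ _).trans (erase_subset _ _)))
      · rw [card_insert_of_notMem huA, hcard]
      · simp [hvA, huv.symm]
  rw [himage, card_image_of_injOn, card_powersetCard]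
  intro A hA B hB hAB
  simp only [mem_coe, mem_powersetCard] at hA hB
  have huA : u ∉ A := fun h => by simpa using hA.1 h
  have huB : u ∉ B := fun h => by simpa using hB.1 h
  rw [← erase_insert huA, ← erase_insert huB]
  exact congrArg (fun C => C.erase u) hAB

theorem cut_eq_sum {V : Type*} [Fintype V] [DecidableEq V]
    (G : SimpleGraph V) [DecidableRel G.Adj] {S T : Finset V} (hTS : T ⊆ S) :
    cut G T = ∑ u ∈ S, ∑ v, if G.Adj u v then (if u ∈ T ∧ v ∉ T then (1 : ℝ) else 0) else 0 := by
  have hset : (T ×ˢ Tᶜ).filter (fun e => G.Adj e.1 e.2) =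
      (S ×ˢ univ).filter fun e => G.Adj e.1 e.2 ∧ (e.1 ∈ T ∧ e.2 ∉ T) := by
    ext ⟨u, v⟩
    simp only [mem_filter, mem_product, mem_compl, mem_univ]
    have := @hTS u
    tauto
  rw [cut, hset, ← sum_product']
  simp only [← ite_and]
  rw [sum_boole]

theorem card_adj_product_eq_sum {V : Type*}
    (G : SimpleGraph V) [DecidableRel G.Adj] (S T : Finset V) :
    (((S ×ˢ T).filter fun e => G.Adj e.1 e.2).card : ℝ) =
      ∑ u ∈ S, ∑ v ∈ T, if G.Adj u v then (1 : ℝ) else 0 := by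
  rw [← sum_product', sum_boole]

/-- The total cut size of the `(j + 1)`-element subsets of `S`. -/
theorem sum_cut_powersetCard {V : Type*} [Fintype V] [DecidableEq V]
    (G : SimpleGraph V) [DecidableRel G.Adj] (S : Finset V)
    (m j : ℕ) (hS : S.card = m + 2) :
    ∑ T ∈ S.powersetCard (j + 1), cut G T =
      ((m + 1).choose j : ℝ) * cut G S +
        (m.choose j : ℝ) * ((S ×ˢ S).filter fun e => G.Adj e.1 e.2).card := by
  have hswap : ∑ T ∈ S.powersetCard (j + 1), cut G T = ∑ u ∈ S, ∑ v, if G.Adj u v then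
      ((((S.erase u).erase v).card.choose j : ℕ) : ℝ) else 0 := by
    rw [sum_congr rfl fun T hT => cut_eq_sum G (mem_powersetCard.1 hT).1, sum_comm]
    refine sum_congr rfl fun u hu => ?_
    rw [sum_comm]
    refine sum_congr rfl fun v _ => ?_
    split_ifs with h
    · rw [sum_boole, card_powersetCard_filter_mem_notMem S j hu h.ne]
    · simp
  rw [hswap, cut, card_adj_product_eq_sum, card_adj_product_eq_sum, mul_sum, mul_sum,
    ← sum_add_distrib]
  refine sum_congr rfl fun u hu => ?_
  have hcard : (S.erase u).card = m + 1 := by rw [card_erase_of_mem hu, hS]; rfl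
  rw [← sum_compl_add_sum S, mul_sum, mul_sum]
  congr 1
  · refine sum_congr rfl fun v hv => ?_
    rw [mem_compl] at hv
    rw [erase_eq_of_notMem fun h => hv (mem_of_mem_erase h), hcard, mul_ite, mul_one, mul_zero]
  · refine sum_congr rfl fun v hv => ?_
    split_ifs with h
    · rw [card_erase_of_mem (mem_erase.2 ⟨h.ne', hv⟩), hcard, mul_one, Nat.add_sub_cancel]
    · rw [mul_zero]

/-- Some `k`-element subset of `S` has cut size at most the average over all of them. -/
theorem exists_cut_le_average {V : Type*} [Fintype V] [DecidableEq V]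
    (G : SimpleGraph V) [DecidableRel G.Adj] (S : Finset V)
    (k : ℕ) (hk : 1 ≤ k) (hkS : k ≤ S.card) (hS : 2 ≤ S.card) :
    ∃ T ⊆ S, T.card = k ∧ cut G T ≤ (k : ℝ) / S.card * cut G S +
      (k : ℝ) * (S.card - k) / (S.card * (S.card - 1)) *
        ((S ×ˢ S).filter fun e => G.Adj e.1 e.2).card := by
  obtain ⟨j, rfl⟩ := Nat.exists_eq_add_of_le' hk
  obtain ⟨m, hm⟩ := Nat.exists_eq_add_of_le' hS
  have hjm : j ≤ m + 1 := by omega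
  have h₁ : ((m : ℝ) + 2) * (m + 1).choose j = (m + 2).choose (j + 1) * (j + 1) := by
    exact_mod_cast Nat.add_one_mul_choose_eq (m + 1) j
  have h₂ : (m.choose j : ℝ) * (m + 1) = (m + 1).choose j * (m + 1 - j) := by
    have := congrArg (Nat.cast (R := ℝ)) (Nat.choose_mul_succ_eq m j)
    push_cast [Nat.cast_sub hjm] at this
    exact this
  have hsum := sum_cut_powersetCard G S m j hm
  obtain ⟨T, hT, hle⟩ := exists_le_of_sum_le (s := S.powersetCard (j + 1))
    (powersetCard_nonempty.2 hkS) (f := cut G)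
    (g := fun _ => ((j + 1 : ℕ) : ℝ) / S.card * cut G S +
      ((j + 1 : ℕ) : ℝ) * (S.card - (j + 1 : ℕ)) / (S.card * (S.card - 1)) *
        ((S ×ˢ S).filter fun e => G.Adj e.1 e.2).card) (by
      rw [hsum, sum_const, card_powersetCard, nsmul_eq_mul, hm]
      have hm1 : (m : ℝ) + 1 ≠ 0 := by positivity
      have hm2 : (m : ℝ) + 2 ≠ 0 := by positivity
      have e₁ : ((m + 1).choose j : ℝ) = (m + 2).choose (j + 1) * ((j + 1) / (m + 2)) := by
        field_simp
        linarith
      have e₂ : (m.choose j : ℝ) =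
          (m + 2).choose (j + 1) * ((j + 1) * (m + 1 - j) / ((m + 2) * (m + 1))) := by
        rw [eq_div_of_mul_eq hm1 h₂, e₁]
        field_simp
      rw [e₁, e₂]
      push_cast
      rw [show (m : ℝ) + 2 - (j + 1) = m + 1 - j by ring,
        show (m : ℝ) + 2 - 1 = m + 1 by ring]
      apply le_of_eq
      ring)
  rw [mem_powersetCard] at hT
  exact ⟨T, hT.1, hT.2, hle⟩

theorem cut_nonneg {V : Type*} [Fintype V] [DecidableEq V]
    (G : SimpleGraph V) [DecidableRel G.Adj] (S : Finset V) : 0 ≤ cut G S :=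
  Nat.cast_nonneg _

theorem vol_eq_of_isRegularOfDegree {V : Type*} [Fintype V]
    {G : SimpleGraph V} [DecidableRel G.Adj] {d : ℕ}
    (hreg : G.IsRegularOfDegree d) (S : Finset V) : vol G S = S.card * d := by
  simp [vol, hreg.degree_eq]

theorem card_adj_product_le_vol {V : Type*} [Fintype V] [DecidableEq V]
    (G : SimpleGraph V) [DecidableRel G.Adj] (S : Finset V) :
    (((S ×ˢ S).filter fun e => G.Adj e.1 e.2).card : ℝ) ≤ vol G S := by
  rw [card_adj_product_eq_sum, vol]
  refine sum_le_sum fun u _ => ?_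
  rw [sum_boole, ← G.card_neighborFinset_eq_degree]
  exact_mod_cast card_le_card fun v hv => by simpa using (mem_filter.1 hv).2

end SSC

/-- Let `G` be `d`-regular, `M ≥ 2`, `k ≥ 1` integers, and `S` with
`|S| = M·k`. Then some `S' ⊆ S` with `|S'| = k` has
`|δ(S')| ≤ |δ(S)| + (2k(Mk−k)/(Mk(Mk−1)))·|E(S)|`, and consequently (as `vol(S') = kd`
and `|E(S)| ≤ Mkd/2`) it satisfies `φ(S') ≤ M·φ(S) + (Mk−k)/(Mk−1)`. -/
theorem regular_subset_small_cut
    {V : Type*} [Fintype V] [DecidableEq V]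
    (G : SimpleGraph V) [DecidableRel G.Adj]
    (d M k : ℕ) (hreg : G.IsRegularOfDegree d) (hM : 2 ≤ M) (hk : 1 ≤ k)
    (S : Finset V) (hScard : S.card = M * k) :
    ∃ S' ⊆ S, S'.card = k ∧
      SSC.cut G S' ≤ SSC.cut G S +
        (2 * (k : ℝ) * ((M : ℝ) * k - k) / ((M : ℝ) * k * ((M : ℝ) * k - 1))) *
          ((((S ×ˢ S).filter fun e => G.Adj e.1 e.2).card : ℝ) / 2) ∧
      SSC.cond G S' ≤ (M : ℝ) * SSC.cond G S + ((M : ℝ) * k - k) / ((M : ℝ) * k - 1) := by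
  have hMk : 2 ≤ M * k := by nlinarith
  have hkMk : k ≤ M * k := Nat.le_mul_of_pos_left k (by omega)
  obtain ⟨T, hTS, hTk, hT⟩ :=
    SSC.exists_cut_le_average G S k hk (hScard ▸ hkMk) (hScard ▸ hMk)
  have hk0 : (0 : ℝ) < k := by exact_mod_cast hk
  have hM0 : (0 : ℝ) < M := by exact_mod_cast (by omega : 0 < M)
  have hn2 : (2 : ℝ) ≤ (M : ℝ) * k := by exact_mod_cast hMk
  have hkn : (k : ℝ) ≤ (M : ℝ) * k := by exact_mod_cast hkMk
  have hn1 : (0 : ℝ) < (M : ℝ) * k - 1 := by linarith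
  have hnk : (0 : ℝ) ≤ (M : ℝ) * k - k := by linarith
  have hcut : SSC.cut G T ≤ SSC.cut G S +
      (2 * (k : ℝ) * ((M : ℝ) * k - k) / ((M : ℝ) * k * ((M : ℝ) * k - 1))) *
        ((((S ×ˢ S).filter fun e => G.Adj e.1 e.2).card : ℝ) / 2) := by
    rw [hScard] at hT
    push_cast at hT
    have hfrac : (k : ℝ) / (M * k) ≤ 1 := div_le_one_of_le₀ hkn (by positivity)
    have hmul := mul_le_of_le_one_left (SSC.cut_nonneg G S) hfrac
    refine hT.trans ((add_le_add_left hmul _).trans (le_of_eq ?_))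
    ring
  refine ⟨T, hTS, hTk, hcut, ?_⟩
  have hE := SSC.card_adj_product_le_vol G S
  rw [SSC.vol_eq_of_isRegularOfDegree hreg, hScard] at hE
  push_cast at hE
  rw [SSC.cond, SSC.cond, SSC.vol_eq_of_isRegularOfDegree hreg,
    SSC.vol_eq_of_isRegularOfDegree hreg, hScard, hTk]
  push_cast
  rcases Nat.eq_zero_or_pos d with rfl | hd
  · simp only [Nat.cast_zero, mul_zero, div_zero, zero_add]
    positivity
  have hd0 : (0 : ℝ) < d := by exact_mod_cast hd
  have hcoef : 0 ≤ 2 * (k : ℝ) * ((M : ℝ) * k - k) / ((M : ℝ) * k * ((M : ℝ) * k - 1)) := by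
    positivity
  rw [div_le_iff₀ (by positivity)]
  refine (hcut.trans (add_le_add_right (mul_le_mul_of_nonneg_left
    (div_le_div_of_nonneg_right hE zero_le_two) hcoef) _)).trans (le_of_eq ?_)
  generalize hq : (M : ℝ) * k - 1 = q at *
  field_simp
end
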